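/- (Effective bulk modulus in equi-biaxial tension.) Let K > 0, η ∈ ℝ, and 0 ≤ d_H < 2/3. Let Φ = diag((1 − (3/2)d_H)^{−1/2}, (1 − (3/2)d_H)^{−1/2}, 1), and let g(Φ) = (1 − η) + η[(1/10)(tr Φ)² + (1/30)tr(Φ²)]. Then the effective bulk modulus K̃ = K / g(Φ) satisfies K̃ = 5K(2 − 3d_H) / [10 − (15 − 13η)d_H − 2η(2 − √(4 − 6d_H))]. Moreover, for η > 0 the right-hand side extends continuously to d_H = 2/3 (i.e., maximal principal damages d₁ = d₂ = 1) with value 0, the denominator there being 14η/3 > 0. -/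

import Mathlib

open Matrix Filter

/-- **Effective bulk modulus in equi-biaxial tension.** With
`Φ = diag((1−(3/2)d_H)^{−1/2}, (1−(3/2)d_H)^{−1/2}, 1)` and
`g(Φ) = (1−η) + η[(1/10)(tr Φ)² + (1/30)tr(Φ²)]`, the effective bulk modulus `K̃ = K/g(Φ)`
equals `5K(2−3d_H)/[10 − (15−13η)d_H − 2η(2−√(4−6d_H))]`; for `η > 0` this expression tends
to `0` as `d_H → (2/3)⁻` (maximal principal damages `d₁ = d₂ = 1`), the denominator there
being `14η/3 > 0`. -/
theorem effective_bulk_modulus_equibiaxial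
    (K η dH : ℝ) (hK : 0 < K) (h0 : 0 ≤ dH) (h1 : dH < 2 / 3)
    (Φ : Matrix (Fin 3) (Fin 3) ℝ)
    (hΦ : Φ = Matrix.diagonal
      ![(1 - 3 / 2 * dH) ^ (-(1 / 2) : ℝ), (1 - 3 / 2 * dH) ^ (-(1 / 2) : ℝ), 1])
    (g : ℝ)
    (hg : g = (1 - η) + η * (1 / 10 * Φ.trace ^ 2 + 1 / 30 * (Φ * Φ).trace)) :
    K / g = 5 * K * (2 - 3 * dH) /
        (10 - (15 - 13 * η) * dH - 2 * η * (2 - Real.sqrt (4 - 6 * dH))) ∧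
      (0 < η →
        10 - (15 - 13 * η) * (2 / 3) - 2 * η * (2 - Real.sqrt (4 - 6 * (2 / 3)))
            = 14 * η / 3 ∧
          0 < 14 * η / 3 ∧
          Tendsto (fun d : ℝ => 5 * K * (2 - 3 * d) /
              (10 - (15 - 13 * η) * d - 2 * η * (2 - Real.sqrt (4 - 6 * d))))
            (nhdsWithin (2 / 3) (Set.Ico 0 (2 / 3))) (nhds 0)) := by
  constructor
  · have hpos : 0 < 1 - 3 / 2 * dH := by linarith
    set s := Real.sqrt (1 - 3 / 2 * dH) with hs
    have hs0 : 0 < s := Real.sqrt_pos.mpr hpos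
    have hs2 : s ^ 2 = 1 - 3 / 2 * dH := Real.sq_sqrt hpos.le
    have hpow : (1 - 3 / 2 * dH) ^ (-(1 / 2) : ℝ) = s⁻¹ := by
      rw [Real.rpow_neg hpos.le, ← Real.sqrt_eq_rpow]
    have hsqrt : Real.sqrt (4 - 6 * dH) = 2 * s := by
      rw [show 4 - 6 * dH = (2 * s) ^ 2 by rw [mul_pow, hs2]; ring]
      exact Real.sqrt_sq (by positivity)
    have hd : dH = 2 / 3 * (1 - s ^ 2) := by rw [hs2]; ring
    have hg' : g = (1 - η) + η * (1 / 10 * (2 * s⁻¹ + 1) ^ 2 + 1 / 30 * (2 * s⁻¹ ^ 2 + 1)) := by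
      rw [hg, hΦ, hpow, Matrix.diagonal_mul_diagonal, Matrix.trace_diagonal,
        Matrix.trace_diagonal, Fin.sum_univ_three, Fin.sum_univ_three]
      simp only [Matrix.cons_val]
      ring
    have hden : 10 - (15 - 13 * η) * dH - 2 * η * (2 - Real.sqrt (4 - 6 * dH))
        = (10 * s ^ 2) * g := by
      rw [hsqrt, hg']
      clear_value s
      subst hd
      field_simp
      ring
    have hnum : 5 * K * (2 - 3 * dH) = (10 * s ^ 2) * K := by rw [hs2]; ring
    rw [hden, hnum, mul_div_mul_left _ _ (by positivity)]
  · intro hη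
    have hden : 10 - (15 - 13 * η) * (2 / 3) - 2 * η * (2 - Real.sqrt (4 - 6 * (2 / 3)))
        = 14 * η / 3 := by
      rw [show (4 - 6 * (2 / 3) : ℝ) = 0 by norm_num, Real.sqrt_zero]
      ring
    have hpos : 0 < 14 * η / 3 := by positivity
    refine ⟨hden, hpos, ?_⟩
    have hcont : ContinuousAt (fun d : ℝ => 5 * K * (2 - 3 * d) /
        (10 - (15 - 13 * η) * d - 2 * η * (2 - Real.sqrt (4 - 6 * d)))) (2 / 3) := by
      refine ContinuousAt.div (by fun_prop) (by fun_prop) ?_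
      rw [hden]
      exact hpos.ne'
    have h := hcont.tendsto
    rw [show 5 * K * (2 - 3 * (2 / 3)) = 0 by ring, zero_div] at h
    exact h.mono_left nhdsWithin_le_nhds
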